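/- Let U ⊆ ℝ⁴ \ {0} be an open conic set and L : U → ℝ a smooth, nowhere-zero function, positively homogeneous of degree 2, whose L-metric g(y) (entries g_{ij}(y) = (1/2)∂²L/∂yⁱ∂yʲ(y)) is invertible on U with inverse entries g^{ij}(y). Let f : U → ℝ be smooth and positively homogeneous of degree 0. Then for every y ∈ U: ( L(y)^{−1}·Σ_{i,j} g^{ij}(y)·∂²(L²·f)/∂yⁱ∂yʲ(y) − 24 f(y) ) · det g(y)/L(y)² = Σ_j ∂/∂yʲ [ (Σ_i g^{ji} ∂f/∂yⁱ)·det g/L ](y). -/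

import Mathlib

noncomputable section

/-- Partial derivative `∂f/∂yⁱ(y)`. -/
def pd (f : (Fin 4 → ℝ) → ℝ) (i : Fin 4) (y : Fin 4 → ℝ) : ℝ :=
  fderiv ℝ f y (Pi.single i 1)

/-- The L-metric: the matrix `g_{ij}(y) = (1/2) ∂²L/∂yⁱ∂yʲ (y)`. -/
def Lmetric (L : (Fin 4 → ℝ) → ℝ) (y : Fin 4 → ℝ) : Matrix (Fin 4) (Fin 4) ℝ :=
  Matrix.of fun i j => (1 / 2) * pd (pd L j) i y


open Matrix in
/-- The determinant as a continuous multilinear map of the rows. -/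
def detCMM : ContinuousMultilinearMap ℝ (fun _ : Fin 4 => Fin 4 → ℝ) ℝ :=
  { (Matrix.detRowAlternating (R := ℝ) (n := Fin 4)).toMultilinearMap with
    cont := by
      change Continuous (fun M : Matrix (Fin 4) (Fin 4) ℝ => M.det)
      exact Continuous.matrix_det continuous_id }

theorem detCMM_apply (M : Fin 4 → Fin 4 → ℝ) : detCMM M = (Matrix.of M).det := rfl

theorem det_updateRow_adj (M : Matrix (Fin 4) (Fin 4) ℝ) (k : Fin 4) (v : Fin 4 → ℝ) :
    (M.updateRow k v).det = ∑ l, M.adjugate l k * v l := by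
  rw [← Matrix.cramer_transpose_apply, Matrix.cramer_eq_adjugate_mulVec,
    ← Matrix.adjugate_transpose]
  rfl

theorem det_hasFDerivAt (M : (Fin 4 → ℝ) → Matrix (Fin 4) (Fin 4) ℝ) (y : Fin 4 → ℝ)
    (hM : ∀ i j, DifferentiableAt ℝ (fun z => M z i j) y) :
    DifferentiableAt ℝ (fun z => (M z).det) y ∧
    ∀ v, fderiv ℝ (fun z => (M z).det) y v =
      ∑ k, ∑ l, (M y).adjugate l k * fderiv ℝ (fun z => M z k l) y v := by
  have h1 : HasFDerivAt (fun z => (fun i j => M z i j : Fin 4 → Fin 4 → ℝ))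
      (ContinuousLinearMap.pi fun i => ContinuousLinearMap.pi fun j =>
        fderiv ℝ (fun z => M z i j) y) y := by
    rw [hasFDerivAt_pi]
    intro i
    rw [hasFDerivAt_pi]
    intro j
    exact (hM i j).hasFDerivAt
  have h2 := (detCMM.hasFDerivAt (fun i j => M y i j)).comp y h1
  have h3 : HasFDerivAt (fun z => (M z).det) _ y := h2
  refine ⟨h3.differentiableAt, fun v => ?_⟩
  rw [h3.fderiv]
  rw [ContinuousLinearMap.comp_apply, ContinuousMultilinearMap.linearDeriv_apply]
  refine Finset.sum_congr rfl fun k _ => ?_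
  exact det_updateRow_adj (M y) k (fun l => fderiv ℝ (fun z => M z k l) y v)

theorem adj_diff (M : (Fin 4 → ℝ) → Matrix (Fin 4) (Fin 4) ℝ) (y : Fin 4 → ℝ)
    (hM : ∀ i j, DifferentiableAt ℝ (fun z => M z i j) y) (i j : Fin 4) :
    DifferentiableAt ℝ (fun z => (M z).adjugate i j) y := by
  simp_rw [Matrix.adjugate_apply]
  refine (det_hasFDerivAt (fun z => (M z).updateRow j (Pi.single i 1)) y ?_).1
  intro a b
  by_cases h : a = j
  · subst h; simp
  · simp [Matrix.updateRow_ne h, hM]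

theorem adj_fderiv (M : (Fin 4 → ℝ) → Matrix (Fin 4) (Fin 4) ℝ) (y : Fin 4 → ℝ)
    (hM : ∀ i j, DifferentiableAt ℝ (fun z => M z i j) y) (hu : IsUnit (M y).det)
    (v : Fin 4 → ℝ) (i j : Fin 4) :
    fderiv ℝ (fun z => (M z).adjugate i j) y v =
      (M y).det * ((∑ k, ∑ l, (M y)⁻¹ l k * fderiv ℝ (fun z => M z k l) y v) * (M y)⁻¹ i j -
        ∑ k, ∑ l, (M y)⁻¹ i k * fderiv ℝ (fun z => M z k l) y v * (M y)⁻¹ l j) := by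
  have hadj : (M y).adjugate = (M y).det • (M y)⁻¹ := by
    rw [Matrix.inv_def, smul_smul, Ring.mul_inverse_cancel _ hu, one_smul]
  set H : Matrix (Fin 4) (Fin 4) ℝ := Matrix.of fun k l => fderiv ℝ (fun z => M z k l) y v with hH
  set A' : Matrix (Fin 4) (Fin 4) ℝ :=
    Matrix.of fun k l => fderiv ℝ (fun z => (M z).adjugate k l) y v with hA'
  set d' : ℝ := fderiv ℝ (fun z => (M z).det) y v with hd'
  have hd2 : d' = (M y).det * ∑ k, ∑ l, (M y)⁻¹ l k * H k l := by
    rw [hd', (det_hasFDerivAt M y hM).2 v, hadj]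
    simp [Finset.mul_sum, hH, mul_assoc]
  have key : H * (M y).adjugate + M y * A' = d' • (1 : Matrix (Fin 4) (Fin 4) ℝ) := by
    refine Matrix.ext fun a b => ?_
    have e : (fun z => ∑ k, M z a k * (M z).adjugate k b) =
        fun z => (M z).det * (1 : Matrix (Fin 4) (Fin 4) ℝ) a b := by
      funext z
      have := congrFun (congrFun (Matrix.mul_adjugate (M z)) a) b
      simpa [Matrix.mul_apply] using this
    have e2 : fderiv ℝ (fun z => ∑ k, M z a k * (M z).adjugate k b) y v =
        fderiv ℝ (fun z => (M z).det * (1 : Matrix (Fin 4) (Fin 4) ℝ) a b) y v := by rw [e]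
    rw [fderiv_fun_sum (fun k _ => (hM a k).fun_mul (adj_diff M y hM k b)),
      fderiv_mul_const (det_hasFDerivAt M y hM).1] at e2
    simp_rw [fderiv_fun_mul (hM a _) (adj_diff M y hM _ b)] at e2
    simp only [Matrix.add_apply, Matrix.mul_apply, Matrix.smul_apply, hH, hA', Matrix.of_apply,
      ← Finset.sum_add_distrib]
    simp only [ContinuousLinearMap.sum_apply, ContinuousLinearMap.add_apply,
      ContinuousLinearMap.smul_apply, smul_eq_mul] at e2
    rw [smul_eq_mul, mul_comm d', ← e2]
    refine Finset.sum_congr rfl fun k _ => by ring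
  have hA2 : A' = (M y)⁻¹ * (d' • (1 : Matrix (Fin 4) (Fin 4) ℝ) - H * (M y).adjugate) := by
    rw [← key, add_sub_cancel_left, ← Matrix.mul_assoc, Matrix.nonsing_inv_mul _ hu,
      Matrix.one_mul]
  have h3 := congrFun (congrFun hA2 i) j
  have h4 : A' i j = fderiv ℝ (fun z => (M z).adjugate i j) y v := rfl
  rw [← h4, h3, Matrix.mul_sub, hadj, Matrix.mul_smul, Matrix.mul_one, Matrix.mul_smul,
    Matrix.mul_smul, Matrix.sub_apply, Matrix.smul_apply, Matrix.smul_apply, hd2]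
  have h5 : ((M y)⁻¹ * (H * (M y)⁻¹)) i j =
      ∑ k, ∑ l, (M y)⁻¹ i k * H k l * (M y)⁻¹ l j := by
    simp only [Matrix.mul_apply, Finset.mul_sum, mul_assoc]
  rw [h5]
  simp only [smul_eq_mul, hH, Matrix.of_apply]
  ring

theorem pd_smooth {U : Set (Fin 4 → ℝ)} (hU : IsOpen U) {F : (Fin 4 → ℝ) → ℝ}
    (hF : ContDiffOn ℝ (⊤ : ℕ∞) F U) (i : Fin 4) : ContDiffOn ℝ (⊤ : ℕ∞) (pd F i) U := by
  have h := hF.fderiv_of_isOpen (m := ((⊤ : ℕ∞) : WithTop ℕ∞)) hU (by simp)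
  exact h.clm_apply contDiffOn_const

theorem smooth_diff {U : Set (Fin 4 → ℝ)} (hU : IsOpen U) {F : (Fin 4 → ℝ) → ℝ}
    (hF : ContDiffOn ℝ (⊤ : ℕ∞) F U) {y} (hy : y ∈ U) : DifferentiableAt ℝ F y :=
  (hF.contDiffAt (hU.mem_nhds hy)).differentiableAt (by simp)

theorem pd_comm {U : Set (Fin 4 → ℝ)} (hU : IsOpen U) {F : (Fin 4 → ℝ) → ℝ}
    (hF : ContDiffOn ℝ (⊤ : ℕ∞) F U) {y} (hy : y ∈ U) (i j : Fin 4) :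
    pd (pd F j) i y = pd (pd F i) j y := by
  have hs : IsSymmSndFDerivAt ℝ F y :=
    (hF.contDiffAt (hU.mem_nhds hy)).isSymmSndFDerivAt (by
      rw [minSmoothness_of_isRCLikeNormedField]; exact WithTop.coe_le_coe.2 (le_top (a := (2 : ℕ∞))))
  have hd : DifferentiableAt ℝ (fderiv ℝ F) y :=
    ((hF.fderiv_of_isOpen (m := ((⊤ : ℕ∞) : WithTop ℕ∞)) hU (by simp)).contDiffAt
      (hU.mem_nhds hy)).differentiableAt (by simp)
  have e : ∀ a b, pd (pd F a) b y = fderiv ℝ (fderiv ℝ F) y (Pi.single b 1) (Pi.single a 1) := by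
    intro a b
    change fderiv ℝ (fun z => fderiv ℝ F z (Pi.single a 1)) y (Pi.single b 1) = _
    rw [fderiv_clm_apply hd (differentiableAt_const _)]
    simp
  rw [e, e]
  exact hs.eq _ _

theorem pd_congr {U : Set (Fin 4 → ℝ)} (hU : IsOpen U) {F G : (Fin 4 → ℝ) → ℝ}
    (h : ∀ z ∈ U, F z = G z) {y} (hy : y ∈ U) (i : Fin 4) : pd F i y = pd G i y := by
  unfold pd
  rw [Filter.EventuallyEq.fderiv_eq (Filter.eventually_of_mem (hU.mem_nhds hy) h)]

theorem pd_mul {F G : (Fin 4 → ℝ) → ℝ} {y} (hF : DifferentiableAt ℝ F y)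
    (hG : DifferentiableAt ℝ G y) (i : Fin 4) :
    pd (fun z => F z * G z) i y = F y * pd G i y + pd F i y * G y := by
  unfold pd
  rw [fderiv_fun_mul hF hG]
  simp [mul_comm]

theorem pd_add {F G : (Fin 4 → ℝ) → ℝ} {y} (hF : DifferentiableAt ℝ F y)
    (hG : DifferentiableAt ℝ G y) (i : Fin 4) :
    pd (fun z => F z + G z) i y = pd F i y + pd G i y := by
  unfold pd
  rw [fderiv_fun_add hF hG]
  simp

theorem pd_sum {F : Fin 4 → (Fin 4 → ℝ) → ℝ} {y} (hF : ∀ k, DifferentiableAt ℝ (F k) y)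
    (i : Fin 4) :
    pd (fun z => ∑ k, F k z) i y = ∑ k, pd (F k) i y := by
  unfold pd
  rw [fderiv_fun_sum (fun k _ => hF k)]
  simp

theorem euler {U : Set (Fin 4 → ℝ)} (hU : IsOpen U) {F : (Fin 4 → ℝ) → ℝ}
    (hF : ContDiffOn ℝ (⊤ : ℕ∞) F U) (n : ℕ)
    (hh : ∀ y ∈ U, ∀ l : ℝ, 0 < l → F (l • y) = l ^ n * F y) {y} (hy : y ∈ U) :
    ∑ k, y k * pd F k y = n * F y := by
  have hd : HasFDerivAt F (fderiv ℝ F y) ((1 : ℝ) • y) := by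
    rw [one_smul]; exact (smooth_diff hU hF hy).hasFDerivAt
  have h1 : HasDerivAt (fun l : ℝ => l • y) y 1 := by
    simpa using (hasDerivAt_id (1 : ℝ)).smul_const y
  have h2 := hd.comp_hasDerivAt (1 : ℝ) h1
  have h3 : HasDerivAt (fun l : ℝ => l ^ n * F y) (n * F y) 1 := by
    simpa using (hasDerivAt_pow n (1 : ℝ)).mul_const (F y)
  have h4 : (F ∘ fun l : ℝ => l • y) =ᶠ[nhds 1] fun l : ℝ => l ^ n * F y :=
    Filter.eventually_of_mem (Ioi_mem_nhds one_pos) fun l hl => hh y hy l hl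
  have h5 := h2.unique (h3.congr_of_eventuallyEq h4)
  rw [← h5]
  have h6 : ∀ T : (Fin 4 → ℝ) →L[ℝ] ℝ, T y = ∑ k, y k * T (Pi.single k 1) := by
    intro T
    conv_lhs => rw [pi_eq_sum_univ' y]
    rw [map_sum]
    refine Finset.sum_congr rfl fun k _ => ?_
    rw [map_smul, smul_eq_mul]
  rw [h6]
  rfl

/-- Second identity of the paper's Lemma 3, in fiber coordinates:
`[L⁻¹ g^{ij} (L²f)_{·i·j} − 24f]·det g/L²` is the divergence of
`X^j = (g^{ji} f_{·i})·det g/L`. -/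
theorem lemma3_second_identity (U : Set (Fin 4 → ℝ)) (hUopen : IsOpen U)
    (hU0 : ∀ y ∈ U, y ≠ (0 : Fin 4 → ℝ))
    (hUconic : ∀ y ∈ U, ∀ l : ℝ, 0 < l → l • y ∈ U)
    (L : (Fin 4 → ℝ) → ℝ) (hLs : ContDiffOn ℝ (⊤ : ℕ∞) L U) (hL0 : ∀ y ∈ U, L y ≠ 0)
    (hhom : ∀ y ∈ U, ∀ l : ℝ, 0 < l → L (l • y) = l ^ 2 * L y)
    (hinv : ∀ y ∈ U, IsUnit (Lmetric L y).det)
    (f : (Fin 4 → ℝ) → ℝ) (hfs : ContDiffOn ℝ (⊤ : ℕ∞) f U)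
    (hfhom : ∀ y ∈ U, ∀ l : ℝ, 0 < l → f (l • y) = f y) :
    ∀ y ∈ U,
      ((1 / L y) * (∑ i : Fin 4, ∑ j : Fin 4,
            (Lmetric L y)⁻¹ i j * pd (pd (fun z => (L z) ^ 2 * f z) j) i y) - 24 * f y) *
          (Lmetric L y).det / (L y) ^ 2 =
      ∑ j : Fin 4,
        fderiv ℝ
          (fun z => (∑ i : Fin 4, (Lmetric L z)⁻¹ j i * pd f i z) *
            (Lmetric L z).det / L z) y (Pi.single j 1) := by

  intro y hy
  have hLp := fun i => pd_smooth hUopen hLs i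
  have hLpp := fun i j => pd_smooth hUopen (hLp i) j
  have hfp := fun i => pd_smooth hUopen hfs i
  have hgs : ∀ i j, DifferentiableAt ℝ (fun z => Lmetric L z i j) y := fun i j =>
    (smooth_diff hUopen (hLpp j i) hy).const_mul (1 / 2)
  have hLij : ∀ i j, pd (pd L j) i y = 2 * Lmetric L y i j := by
    intro i j; simp [Lmetric]
  have gsym : (Lmetric L y).transpose = Lmetric L y := by
    ext i j
    simp only [Matrix.transpose_apply, Lmetric, Matrix.of_apply]
    rw [pd_comm hUopen hLs hy]
  have Isym : ∀ i j, (Lmetric L y)⁻¹ i j = (Lmetric L y)⁻¹ j i := by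
    intro i j
    have h := Matrix.transpose_nonsing_inv (Lmetric L y)
    rw [gsym] at h
    exact congrFun (congrFun h j) i
  have hC : ∀ k l j, fderiv ℝ (fun z => Lmetric L z k l) y (Pi.single j 1) =
      (1 / 2) * pd (pd (pd L l) k) j y := by
    intro k l j
    change fderiv ℝ (fun z => (1 / 2) * pd (pd L l) k z) y (Pi.single j 1) = _
    rw [fderiv_const_mul (smooth_diff hUopen (hLpp l k) hy)]
    simp [pd]
  have T12 : ∀ a b c, pd (pd (pd L a) b) c y = pd (pd (pd L a) c) b y := fun a b c =>
    pd_comm hUopen (hLp a) hy c b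
  have T01 : ∀ a b c, pd (pd (pd L a) b) c y = pd (pd (pd L b) a) c y := fun a b c =>
    pd_congr hUopen (fun z hz => pd_comm hUopen hLs hz b a) hy c
  -- Euler relations
  have Ef : ∑ k, y k * pd f k y = 0 := by
    have := euler hUopen hfs 0 (fun z hz l hl => by simp [hfhom z hz l hl]) hy
    simpa using this
  have EL : ∀ z ∈ U, ∑ k, z k * pd L k z = 2 * L z := by
    intro z hz
    have := euler hUopen hLs 2 hhom hz
    exact_mod_cast this
  have hcoord : ∀ k : Fin 4, DifferentiableAt ℝ (fun z : Fin 4 → ℝ => z k) y := fun k => by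
    fun_prop
  have hpcoord : ∀ k i : Fin 4, pd (fun z : Fin 4 → ℝ => z k) i y = if k = i then 1 else 0 := by
    intro k i
    unfold pd
    have h : HasFDerivAt (fun z : Fin 4 → ℝ => z k)
      (ContinuousLinearMap.proj (R := ℝ) (φ := fun _ : Fin 4 => ℝ) k) y :=
      (ContinuousLinearMap.proj (R := ℝ) (φ := fun _ : Fin 4 => ℝ) k).hasFDerivAt
    rw [h.fderiv]
    simp [Pi.single_apply]
  have EL1 : ∀ i, pd L i y = 2 * ∑ k, Lmetric L y i k * y k := by
    intro i
    have h1 := pd_congr hUopen EL hy i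
    rw [pd_sum (fun k => (hcoord k).fun_mul (smooth_diff hUopen (hLp k) hy)),
      pd_mul (differentiableAt_const _) (smooth_diff hUopen hLs hy)] at h1
    simp_rw [pd_mul (hcoord _) (smooth_diff hUopen (hLp _) hy), hpcoord, hLij] at h1
    have h0 : pd (fun _ : Fin 4 → ℝ => (2 : ℝ)) i y = 0 := by simp [pd]
    rw [h0, Finset.sum_add_distrib] at h1
    simp only [ite_mul, one_mul, zero_mul, Finset.sum_ite_eq', Finset.mem_univ, if_true,
      add_zero] at h1
    have h2 : ∑ k, y k * (2 * Lmetric L y i k) = 2 * ∑ k, Lmetric L y i k * y k := by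
      rw [Finset.mul_sum]; exact Finset.sum_congr rfl fun k _ => by ring
    linarith
  have hu := hinv y hy
  have hL := hL0 y hy
  have IL : ∀ i, ∑ j, (Lmetric L y)⁻¹ i j * pd L j y = 2 * y i := by
    intro i
    have h1 : (fun j => pd L j y) = (2 : ℝ) • (Lmetric L y).mulVec y := by
      funext j; rw [EL1]; rfl
    have h2 : (Lmetric L y)⁻¹.mulVec (fun j => pd L j y) = (2 : ℝ) • y := by
      rw [h1, Matrix.mulVec_smul, Matrix.mulVec_mulVec, Matrix.nonsing_inv_mul _ hu,
        Matrix.one_mulVec]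
    exact congrFun h2 i
  have S1 : ∑ i, ∑ j, (Lmetric L y)⁻¹ i j * (pd L i y * pd L j y) = 4 * L y := by
    have : ∀ i, ∑ j, (Lmetric L y)⁻¹ i j * (pd L i y * pd L j y) = 2 * (y i * pd L i y) := by
      intro i
      rw [← mul_assoc, ← IL i, Finset.sum_mul]
      exact Finset.sum_congr rfl fun j _ => by ring
    rw [Finset.sum_congr rfl fun i _ => this i, ← Finset.mul_sum, EL y hy]
    ring
  have S2 : ∑ i, ∑ j, (Lmetric L y)⁻¹ i j * Lmetric L y i j = 4 := by
    have h1 : ∀ i, ∑ j, (Lmetric L y)⁻¹ i j * Lmetric L y i j = 1 := by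
      intro i
      have h := congrFun (congrFun (Matrix.nonsing_inv_mul _ hu) i) i
      rw [Matrix.mul_apply, Matrix.one_apply_eq] at h
      rw [← h]
      refine Finset.sum_congr rfl fun j _ => ?_
      rw [show Lmetric L y j i = Lmetric L y i j from congrFun (congrFun gsym i) j]
    simp [h1]
  have S4 : ∑ i, ∑ j, (Lmetric L y)⁻¹ i j * (pd f i y * pd L j y) = 0 := by
    have : ∀ i, ∑ j, (Lmetric L y)⁻¹ i j * (pd f i y * pd L j y) = 2 * (y i * pd f i y) := by
      intro i
      rw [← mul_assoc, ← IL i, Finset.sum_mul]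
      exact Finset.sum_congr rfl fun j _ => by ring
    rw [Finset.sum_congr rfl fun i _ => this i, ← Finset.mul_sum, Ef]
    ring
  have S3 : ∑ i, ∑ j, (Lmetric L y)⁻¹ i j * (pd L i y * pd f j y) = 0 := by
    rw [Finset.sum_comm, ← S4]
    refine Finset.sum_congr rfl fun i _ => Finset.sum_congr rfl fun j _ => ?_
    rw [Isym j i]; ring
  -- second derivatives of `L² f`
  have P1 : ∀ j, ∀ z ∈ U, pd (fun z => (L z) ^ 2 * f z) j z =
      (L z * L z) * pd f j z + (2 * (L z * pd L j z)) * f z := by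
    intro j z hz
    have dL := smooth_diff hUopen hLs hz
    simp_rw [pow_two]
    rw [pd_mul (dL.fun_mul dL) (smooth_diff hUopen hfs hz), pd_mul dL dL]
    ring
  have P2 : ∀ i j, pd (pd (fun z => (L z) ^ 2 * f z) j) i y =
      (2 * f y) * (pd L i y * pd L j y) + (4 * L y * f y) * Lmetric L y i j +
      (2 * L y) * (pd f i y * pd L j y) + (2 * L y) * (pd L i y * pd f j y) +
      (L y) ^ 2 * pd (pd f j) i y := by
    intro i j
    have dL := smooth_diff hUopen hLs hy
    have df := smooth_diff hUopen hfs hy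
    have dLj := smooth_diff hUopen (hLp j) hy
    have dfj := smooth_diff hUopen (hfp j) hy
    rw [pd_congr hUopen (P1 j) hy i,
      pd_add ((dL.fun_mul dL).fun_mul dfj) (((dL.fun_mul dLj).const_mul 2).fun_mul df),
      pd_mul (dL.fun_mul dL) dfj, pd_mul dL dL, pd_mul ((dL.fun_mul dLj).const_mul 2) df,
      pd_mul (differentiableAt_const _) (dL.fun_mul dLj), pd_mul dL dLj, hLij]
    have h0 : pd (fun _ : Fin 4 → ℝ => (2 : ℝ)) i y = 0 := by simp [pd]
    rw [h0]
    ring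
  set S5 := ∑ i, ∑ j, (Lmetric L y)⁻¹ i j * pd (pd f j) i y with hS5
  have hLHS : ∑ i : Fin 4, ∑ j : Fin 4,
      (Lmetric L y)⁻¹ i j * pd (pd (fun z => (L z) ^ 2 * f z) j) i y =
      24 * L y * f y + (L y) ^ 2 * S5 := by
    have h : ∑ i : Fin 4, ∑ j : Fin 4,
      (Lmetric L y)⁻¹ i j * pd (pd (fun z => (L z) ^ 2 * f z) j) i y =
      (2 * f y) * (∑ i, ∑ j, (Lmetric L y)⁻¹ i j * (pd L i y * pd L j y)) +
      (4 * L y * f y) * (∑ i, ∑ j, (Lmetric L y)⁻¹ i j * Lmetric L y i j) +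
      (2 * L y) * (∑ i, ∑ j, (Lmetric L y)⁻¹ i j * (pd f i y * pd L j y)) +
      (2 * L y) * (∑ i, ∑ j, (Lmetric L y)⁻¹ i j * (pd L i y * pd f j y)) +
      (L y) ^ 2 * S5 := by
      rw [hS5]
      simp only [Finset.mul_sum, ← Finset.sum_add_distrib]
      refine Finset.sum_congr rfl fun i _ => Finset.sum_congr rfl fun j _ => ?_
      rw [P2]; ring
    rw [h, S1, S2, S3, S4]; ring
  -- the divergence
  have hadj : ∀ z ∈ U, (Lmetric L z).adjugate = (Lmetric L z).det • (Lmetric L z)⁻¹ := by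
    intro z hz
    rw [Matrix.inv_def, smul_smul, Ring.mul_inverse_cancel _ (hinv z hz), one_smul]
  have hdiv : ∀ i, ∑ j, pd (fun z => (Lmetric L z).adjugate j i) j y = 0 := by
    intro i
    have h1 : ∀ j, pd (fun z => (Lmetric L z).adjugate j i) j y = (Lmetric L y).det *
        ((∑ k, ∑ l, (Lmetric L y)⁻¹ l k * ((1 / 2) * pd (pd (pd L l) k) j y)) *
            (Lmetric L y)⁻¹ j i -
          ∑ k, ∑ l, (Lmetric L y)⁻¹ j k * ((1 / 2) * pd (pd (pd L l) k) j y) *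
            (Lmetric L y)⁻¹ l i) := by
      intro j
      have h := adj_fderiv (Lmetric L) y hgs hu (Pi.single j 1) j i
      simp only [hC] at h
      exact h
    simp only [h1]
    rw [← Finset.mul_sum, Finset.sum_sub_distrib]
    have h2 : ∑ j, ∑ k, ∑ l, (Lmetric L y)⁻¹ j k * ((1 / 2) * pd (pd (pd L l) k) j y) *
            (Lmetric L y)⁻¹ l i =
        ∑ j, (∑ k, ∑ l, (Lmetric L y)⁻¹ l k * ((1 / 2) * pd (pd (pd L l) k) j y)) *
            (Lmetric L y)⁻¹ j i := by
      simp only [Finset.sum_mul]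
      rw [Finset.sum_comm]
      conv_lhs => enter [2, k]; rw [Finset.sum_comm]
      rw [Finset.sum_comm]
      refine Finset.sum_congr rfl fun j _ => Finset.sum_congr rfl fun k _ =>
        Finset.sum_congr rfl fun l _ => ?_
      rw [T01 j k l, T12 k j l, T01 k l j]
    rw [h2, sub_self, mul_zero]
  have hX : ∀ j, fderiv ℝ (fun z => (∑ i : Fin 4, (Lmetric L z)⁻¹ j i * pd f i z) *
            (Lmetric L z).det / L z) y (Pi.single j 1) =
      (∑ i, pd (fun z => (Lmetric L z).adjugate j i) j y * pd f i y) * (L y)⁻¹ +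
      (Lmetric L y).det * (L y)⁻¹ * (∑ i, (Lmetric L y)⁻¹ j i * pd (pd f i) j y) -
      (Lmetric L y).det * ((L y) ^ 2)⁻¹ * ∑ i, (Lmetric L y)⁻¹ j i * (pd L j y * pd f i y) := by
    intro j
    have hc : ∀ z ∈ U, (∑ i : Fin 4, (Lmetric L z)⁻¹ j i * pd f i z) *
            (Lmetric L z).det / L z =
        (∑ i : Fin 4, (Lmetric L z).adjugate j i * pd f i z) * (L z)⁻¹ := by
      intro z hz
      rw [hadj z hz, div_eq_mul_inv, Finset.sum_mul]
      congr 1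
      refine Finset.sum_congr rfl fun i _ => ?_
      rw [Matrix.smul_apply, smul_eq_mul]; ring
    have hp := pd_congr hUopen hc hy j
    have dL := smooth_diff hUopen hLs hy
    have da := fun i => adj_diff (Lmetric L) y hgs j i
    have dfi := fun i => smooth_diff hUopen (hfp i) hy
    have hinvL : pd (fun z => (L z)⁻¹) j y = -((L y) ^ 2)⁻¹ * pd L j y := by
      unfold pd
      have h : HasFDerivAt (fun z => (L z)⁻¹) _ y :=
        (hasDerivAt_inv hL).comp_hasFDerivAt y dL.hasFDerivAt
      rw [h.fderiv]
      simp
    have hs : DifferentiableAt ℝ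
        (fun z => ∑ i : Fin 4, (Lmetric L z).adjugate j i * pd f i z) y :=
      DifferentiableAt.fun_sum fun i _ => (da i).fun_mul (dfi i)
    rw [pd_mul hs (dL.fun_inv hL), hinvL,
      pd_sum (fun i => (da i).fun_mul (dfi i))] at hp
    simp_rw [pd_mul (da _) (dfi _), hadj y hy, Matrix.smul_apply, smul_eq_mul] at hp
    refine hp.trans ?_
    rw [Finset.sum_add_distrib]
    have e1 : ∑ i, (Lmetric L y).det * (Lmetric L y)⁻¹ j i * pd f i y * pd L j y =
      (Lmetric L y).det * ∑ i, (Lmetric L y)⁻¹ j i * (pd L j y * pd f i y) := by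
      rw [Finset.mul_sum]; exact Finset.sum_congr rfl fun i _ => by ring
    have e2 : ∑ i, (Lmetric L y).det * (Lmetric L y)⁻¹ j i * pd (pd f i) j y =
      (Lmetric L y).det * ∑ i, (Lmetric L y)⁻¹ j i * pd (pd f i) j y := by
      rw [Finset.mul_sum]; exact Finset.sum_congr rfl fun i _ => by ring
    rw [← Finset.sum_mul] at e1
    rw [e2]
    linear_combination (-((L y) ^ 2)⁻¹) * e1
  rw [hLHS, Finset.sum_congr rfl fun j _ => hX j, Finset.sum_sub_distrib, Finset.sum_add_distrib,
    ← Finset.sum_mul, ← Finset.mul_sum, ← Finset.mul_sum, S3, ← hS5, Finset.sum_comm]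
  have hz : ∑ i, ∑ j, pd (fun z => (Lmetric L z).adjugate j i) j y * pd f i y = 0 := by
    refine Finset.sum_eq_zero fun i _ => ?_
    rw [← Finset.sum_mul, hdiv, zero_mul]
  rw [hz]
  field_simp
  ring
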